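/- Let (X,d) be an unbounded metric space, p ∈ X, and n ≥ 2. Define F_n(x_1, …, x_n) := (min_{1≤k≤n} d(x_k,p) · ∏_{1≤k<l≤n} d(x_k,x_l)) / (max_{1≤k≤n} d(x_k,p))^{n(n−1)/2 + 1} for (x_1,…,x_n) ≠ (p,…,p), and F_n(p,…,p) := 0. Then the inequality |Ω_{∞,r̃}^X| ≤ n holds for every pretangent space Ω_{∞,r̃}^X (for every scaling sequence r̃) if and only if F_n(x_1, …, x_n) → 0 as x_1, …, x_n → ∞ (i.e., as min_{1≤k≤n} d(x_k, p) → ∞). -/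

import Mathlib

open Filter Topology

/-- A scaling sequence: a sequence of positive reals tending to infinity. -/
def ScalingSeq (r : ℕ → ℝ) : Prop :=
  (∀ n, 0 < r n) ∧ Tendsto r atTop atTop

/-- `x ∈ X̃_{∞,r̃}`: the sequence `x` satisfies `d(x_n,p) → ∞` and the finite limit
`d̃_r̃(x̃) = lim d(x_n,p)/r_n` exists.  Here `d` is the distance function of the space. -/
def SeqAdm {Y : Type*} (d : Y → Y → ℝ) (p : Y) (r : ℕ → ℝ) (x : ℕ → Y) : Prop :=
  Tendsto (fun n => d (x n) p) atTop atTop ∧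
  ∃ L : ℝ, Tendsto (fun n => d (x n) p / r n) atTop (𝓝 L)

/-- The equivalence `x̃ ≡ ỹ ⇔ lim d(x_n,y_n)/r_n = 0`. -/
def SeqEquiv {Y : Type*} (d : Y → Y → ℝ) (r : ℕ → ℝ) (x y : ℕ → Y) : Prop :=
  Tendsto (fun n => d (x n) (y n) / r n) atTop (𝓝 0)

/-- Mutual stability: the limit `lim d(x_n,y_n)/r_n` exists (and is finite). -/
def MutStable {Y : Type*} (d : Y → Y → ℝ) (r : ℕ → ℝ) (x y : ℕ → Y) : Prop :=
  ∃ L : ℝ, Tendsto (fun n => d (x n) (y n) / r n) atTop (𝓝 L)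

/-- A set of sequences representing a clique in the graph `G_{X,r̃}`: all members are
admissible, the set is a union of equivalence classes, and all members are pairwise
mutually stable. -/
def IsCliqueSet {Y : Type*} (d : Y → Y → ℝ) (p : Y) (r : ℕ → ℝ) (C : Set (ℕ → Y)) : Prop :=
  (∀ x ∈ C, SeqAdm d p r x) ∧
  (∀ x ∈ C, ∀ y, SeqAdm d p r y → SeqEquiv d r x y → y ∈ C) ∧
  (∀ x ∈ C, ∀ y ∈ C, MutStable d r x y)

/-- A pretangent space `Ω^X_{∞,r̃}`, encoded as the (union of the) maximal clique of the
graph `G_{X,r̃}`. -/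
def IsPretangent {Y : Type*} (d : Y → Y → ℝ) (p : Y) (r : ℕ → ℝ) (C : Set (ℕ → Y)) : Prop :=
  IsCliqueSet d p r C ∧ ∀ D, IsCliqueSet d p r D → C ⊆ D → D = C

/-- The point `α₀ = α₀(X,r̃)`: the class of admissible sequences with `d̃_r̃(x̃) = 0`. -/
def alphaZero {Y : Type*} (d : Y → Y → ℝ) (p : Y) (r : ℕ → ℝ) : Set (ℕ → Y) :=
  {x | SeqAdm d p r x ∧ Tendsto (fun n => d (x n) p / r n) atTop (𝓝 0)}

/-- The metric `ρ` of a pretangent space: `ρ(α,β) = lim d(x_n,y_n)/r_n`. -/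
noncomputable def seqDist {Y : Type*} (d : Y → Y → ℝ) (r : ℕ → ℝ) (x y : ℕ → Y) : ℝ :=
  limUnder atTop (fun n => d (x n) (y n) / r n)

open scoped Classical

/-- The function `F_n` of Theorem 2.1:
`F_n(x₁,…,xₙ) = (min_k d(x_k,p) · ∏_{k<l} d(x_k,x_l)) / (max_k d(x_k,p))^{n(n-1)/2+1}`
for `(x₁,…,xₙ) ≠ (p,…,p)`, and `F_n(p,…,p) = 0`. -/
noncomputable def Fn {X : Type*} [MetricSpace X] (p : X) {n : ℕ} (x : Fin n → X) : ℝ :=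
  if ∀ k, x k = p then 0
  else ((⨅ k, dist (x k) p) *
      ∏ q ∈ Finset.univ.filter (fun q : Fin n × Fin n => q.1 < q.2), dist (x q.1) (x q.2)) /
    (⨆ k, dist (x k) p) ^ (n * (n - 1) / 2 + 1)

/-- The admissible sequences equivalent to a member of a pairwise mutually stable family form a
clique. -/
lemma isCliqueSet_saturation {Y ι : Type*} [PseudoMetricSpace Y] {p : Y} {r : ℕ → ℝ}
    (hr : ScalingSeq r) {f : ι → ℕ → Y} (hs : ∀ k l, MutStable dist r (f k) (f l)) :
    IsCliqueSet dist p r {y | SeqAdm dist p r y ∧ ∃ k, SeqEquiv dist r (f k) y} := by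
  refine ⟨fun x hx => hx.1, ?_, ?_⟩
  · rintro x ⟨-, k, hk⟩ y hy hxy
    refine ⟨hy, k, squeeze_zero (fun m => div_nonneg dist_nonneg (hr.1 m).le) (fun m => ?_)
      (by simpa using Tendsto.add hk hxy)⟩
    rw [← add_div]
    exact div_le_div_of_nonneg_right (dist_triangle _ _ _) (hr.1 m).le
  · rintro x ⟨-, k, hk⟩ y ⟨-, l, hl⟩
    obtain ⟨L, hL⟩ := hs k l
    refine ⟨L, ?_⟩
    have h0 : Tendsto (fun m => dist (x m) (y m) / r m - dist (f k m) (f l m) / r m) atTop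
        (𝓝 0) := by
      refine squeeze_zero_norm (fun m => ?_) (by simpa using Tendsto.add hk hl)
      rw [← sub_div, ← add_div, norm_div, Real.norm_of_nonneg (hr.1 m).le, Real.norm_eq_abs]
      refine div_le_div_of_nonneg_right ?_ (hr.1 m).le
      rw [dist_comm (f k m) (x m), dist_comm (f l m) (y m), ← Real.dist_eq]
      exact dist_dist_dist_le _ _ _ _
    simpa using h0.add hL

/-- Every clique is contained in a pretangent space. -/
lemma IsCliqueSet.exists_isPretangent {Y : Type*} {d : Y → Y → ℝ} {p : Y} {r : ℕ → ℝ}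
    {C : Set (ℕ → Y)} (hC : IsCliqueSet d p r C) : ∃ D, IsPretangent d p r D ∧ C ⊆ D := by
  obtain ⟨D, hCD, hD⟩ := zorn_subset_nonempty {D | IsCliqueSet d p r D} (fun c hc hch _ => by
    refine ⟨⋃₀ c, ⟨?_, ?_, ?_⟩, fun s hs => Set.subset_sUnion_of_mem hs⟩
    · rintro x ⟨s, hs, hx⟩
      exact (hc hs).1 x hx
    · rintro x ⟨s, hs, hx⟩ y hy hxy
      exact ⟨s, hs, (hc hs).2.1 x hx y hy hxy⟩
    · rintro x ⟨s, hs, hx⟩ y ⟨t, ht, hy⟩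
      rcases hch.total hs ht with h | h
      · exact (hc ht).2.2 x (h hx) y hy
      · exact (hc hs).2.2 x hx y (h hy)) C hC
  exact ⟨D, ⟨hD.prop, fun E hE hDE => (hD.eq_of_subset hE hDE).symm⟩, hCD⟩

lemma Fin.card_filter_fst_lt_snd (n : ℕ) :
    (Finset.univ.filter (fun q : Fin n × Fin n => q.1 < q.2)).card = n * (n - 1) / 2 := by
  rw [Finset.card_filter, Fintype.sum_prod_type_right, ← Finset.sum_range_id_mul_two,
    Nat.mul_div_cancel _ two_pos, ← Fin.sum_univ_eq_sum_range (fun i => i)]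
  refine Finset.sum_congr rfl fun i _ => ?_
  rw [← Finset.card_filter, Finset.filter_gt_eq_Iio, Fin.card_Iio]

/-- `F_n` as a product of distances divided by the largest distance to `p`. -/
lemma Fn_eq_mul_prod {X : Type*} [MetricSpace X] {p : X} {n : ℕ} {x : Fin n → X}
    (hx : ¬ ∀ k, x k = p) :
    Fn p x = (⨅ k, dist (x k) p) / (⨆ k, dist (x k) p) *
      ∏ q ∈ Finset.univ.filter (fun q : Fin n × Fin n => q.1 < q.2),
        dist (x q.1) (x q.2) / (⨆ k, dist (x k) p) := by
  rw [Fn, if_neg hx, Finset.prod_div_distrib, Finset.prod_const, Fin.card_filter_fst_lt_snd,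
    div_mul_div_comm, pow_succ']

lemma dist_le_iSup_dist {X : Type*} [MetricSpace X] (p : X) {n : ℕ} (x : Fin n → X) (k : Fin n) :
    dist (x k) p ≤ ⨆ k, dist (x k) p :=
  le_ciSup (f := fun k => dist (x k) p) (Set.finite_range _).bddAbove k

lemma dist_div_iSup_dist_le_two {X : Type*} [MetricSpace X] (p : X) {n : ℕ} (x : Fin n → X)
    (k l : Fin n) : dist (x k) (x l) / (⨆ k, dist (x k) p) ≤ 2 := by
  have h := dist_le_iSup_dist p x k
  have h' := dist_le_iSup_dist p x l
  refine div_le_of_le_mul₀ (dist_nonneg.trans h) zero_le_two ?_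
  linarith [dist_triangle_right (x k) (x l) p]

lemma iInf_dist_div_iSup_dist_le_one {X : Type*} [MetricSpace X] (p : X) {n : ℕ}
    (x : Fin n → X) (k : Fin n) :
    (⨅ k, dist (x k) p) / (⨆ k, dist (x k) p) ≤ 1 :=
  div_le_one_of_le₀ ((ciInf_le (Set.finite_range _).bddBelow k).trans (dist_le_iSup_dist p x k))
    (dist_nonneg.trans (dist_le_iSup_dist p x k))

lemma Fn_le_mul_dist_point {X : Type*} [MetricSpace X] {p : X} {n : ℕ} {x : Fin n → X}
    (hx : ¬ ∀ k, x k = p) (k : Fin n) :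
    Fn p x ≤ 2 ^ (n * (n - 1) / 2) * (dist (x k) p / (⨆ k, dist (x k) p)) := by
  have h0 : 0 ≤ ⨆ k, dist (x k) p := dist_nonneg.trans (dist_le_iSup_dist p x k)
  rw [Fn_eq_mul_prod hx, mul_comm, ← Fin.card_filter_fst_lt_snd]
  refine mul_le_mul ?_ ?_ (div_nonneg (Real.iInf_nonneg fun _ => dist_nonneg) h0) (by positivity)
  · rw [← Finset.prod_const]
    exact Finset.prod_le_prod (fun _ _ => div_nonneg dist_nonneg h0)
      fun q _ => dist_div_iSup_dist_le_two p x _ _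
  · exact div_le_div_of_nonneg_right (ciInf_le (Set.finite_range _).bddBelow k) h0

lemma Fn_le_mul_dist_pair {X : Type*} [MetricSpace X] {p : X} {n : ℕ} {x : Fin n → X}
    (hx : ¬ ∀ k, x k = p) {k l : Fin n} (hkl : k ≠ l) :
    Fn p x ≤ 2 ^ (n * (n - 1) / 2) * (dist (x k) (x l) / (⨆ k, dist (x k) p)) := by
  wlog h : k < l generalizing k l
  · rw [dist_comm]
    exact this hkl.symm (hkl.lt_or_gt.resolve_left h)
  have h0 : 0 ≤ ⨆ k, dist (x k) p := dist_nonneg.trans (dist_le_iSup_dist p x k)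
  have hmem : (k, l) ∈ Finset.univ.filter (fun q : Fin n × Fin n => q.1 < q.2) := by simpa using h
  rw [Fn_eq_mul_prod hx]
  refine (mul_le_of_le_one_left (Finset.prod_nonneg fun q _ => div_nonneg dist_nonneg h0)
    (iInf_dist_div_iSup_dist_le_one p x k)).trans ?_
  rw [← Finset.prod_erase_mul _ _ hmem]
  refine mul_le_mul_of_nonneg_right ?_ (div_nonneg dist_nonneg h0)
  refine (Finset.prod_le_prod (fun _ _ => div_nonneg dist_nonneg h0)
    fun q _ => dist_div_iSup_dist_le_two p x _ _).trans ?_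
  rw [Finset.prod_const, ← Fin.card_filter_fst_lt_snd]
  exact pow_le_pow_right₀ one_le_two (Finset.card_le_card (Finset.erase_subset _ _))

/-- If all distances to `p` lie in `[c * s, K * s]` and all mutual distances are at least `c * s`,
then `F_n` is bounded below independently of the scale `s`. -/
lemma le_Fn {X : Type*} [MetricSpace X] {p : X} {n : ℕ} [Nonempty (Fin n)] {x : Fin n → X}
    {c K s : ℝ} (hc : 0 < c) (hs : 0 < s) (hl : ∀ k, c ≤ dist (x k) p / s)
    (hu : ∀ k, dist (x k) p / s ≤ K) (hd : ∀ k l, k ≠ l → c ≤ dist (x k) (x l) / s) :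
    (c / K) * (c / K) ^ (n * (n - 1) / 2) ≤ Fn p x := by
  obtain ⟨k₀⟩ := ‹Nonempty (Fin n)›
  have : Nonempty (Fin n) := ⟨k₀⟩
  simp only [le_div_iff₀ hs] at hl hd
  simp only [div_le_iff₀ hs] at hu
  have hpos : 0 < dist (x k₀) p := (mul_pos hc hs).trans_le (hl k₀)
  have hK : 0 < K := pos_of_mul_pos_left (hpos.trans_le (hu k₀)) hs.le
  have hS : 0 < ⨆ k, dist (x k) p := hpos.trans_le (dist_le_iSup_dist p x k₀)
  have hSK : (⨆ k, dist (x k) p) ≤ K * s := ciSup_le hu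
  have key : ∀ t, c * s ≤ t → c / K ≤ t / (⨆ k, dist (x k) p) := by
    intro t ht
    rw [← mul_div_mul_right c K hs.ne']
    exact div_le_div₀ ((mul_pos hc hs).le.trans ht) ht hS hSK
  have hcK : 0 < c / K := div_pos hc hK
  rw [Fn_eq_mul_prod fun h => hpos.ne' (by rw [h k₀, dist_self])]
  refine mul_le_mul (key _ (le_ciInf hl)) ?_ (by positivity)
    (hcK.le.trans (key _ (le_ciInf hl)))
  rw [← Fin.card_filter_fst_lt_snd, ← Finset.prod_const]
  exact Finset.prod_le_prod (fun _ _ => hcK.le) fun q hq =>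
    key _ (hd _ _ (Finset.mem_filter.1 hq).2.ne)

/-- If `F_n → 0`, then no clique contains `n + 1` pairwise inequivalent sequences. -/
lemma exists_seqEquiv_of_Fn_small {X : Type*} [MetricSpace X] {p : X} {n : ℕ} [Nonempty (Fin n)]
    (hF : ∀ ε > (0 : ℝ), ∃ M : ℝ, ∀ x : Fin n → X, (∀ k, M ≤ dist (x k) p) → Fn p x < ε)
    {r : ℕ → ℝ} (hr : ScalingSeq r) {f : Fin (n + 1) → ℕ → X}
    (hf : ∀ k, SeqAdm dist p r (f k)) (hs : ∀ k l, MutStable dist r (f k) (f l)) :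
    ∃ k l, k ≠ l ∧ SeqEquiv dist r (f k) (f l) := by
  by_contra! hne
  choose L hL using fun k => (hf k).2
  choose D hD using hs
  have hLnn : ∀ k, 0 ≤ L k := fun k =>
    ge_of_tendsto' (hL k) fun m => div_nonneg dist_nonneg (hr.1 m).le
  have hDpos : ∀ k l, k ≠ l → 0 < D k l := by
    intro k l hkl
    refine lt_of_le_of_ne
      (ge_of_tendsto' (hD k l) fun m => div_nonneg dist_nonneg (hr.1 m).le) fun h => ?_
    exact hne k l hkl (by simpa only [SeqEquiv, h] using hD k l)
  have hLD : ∀ k l, D k l ≤ L k + L l := fun k l =>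
    le_of_tendsto_of_tendsto' (hD k l) ((hL k).add (hL l)) fun m => by
      rw [← add_div]
      exact div_le_div_of_nonneg_right (dist_triangle_right _ _ _) (hr.1 m).le
  obtain ⟨k₀, hk₀⟩ : ∃ k₀, ∀ k, k ≠ k₀ → 0 < L k := by
    by_cases h : ∃ k₀, L k₀ = 0
    · obtain ⟨k₀, h0⟩ := h
      refine ⟨k₀, fun k hk => ?_⟩
      linarith [hDpos k k₀ hk, hLD k k₀]
    · push Not at h
      exact ⟨0, fun k _ => (hLnn k).lt_of_ne' (h k)⟩
  let e := k₀.succAbove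
  obtain ⟨c, ⟨hcL, hcD⟩, hc⟩ : ∃ c : ℝ, ((∀ k, c < L (e k)) ∧ ∀ q : Fin n × Fin n, q.1 ≠ q.2 →
      c < D (e q.1) (e q.2)) ∧ 0 < c := by
    refine (((eventually_all.2 fun k => ?_).and (eventually_all.2 fun q => ?_)).and
      (self_mem_nhdsWithin : Set.Ioi (0 : ℝ) ∈ 𝓝[>] 0)).exists
    · exact (eventually_lt_nhds (hk₀ _ (Fin.succAbove_ne _ _))).filter_mono nhdsWithin_le_nhds
    · by_cases hq : q.1 = q.2
      · exact Eventually.of_forall fun c h => absurd hq h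
      · filter_upwards [(eventually_lt_nhds (hDpos (e q.1) (e q.2)
          (Fin.succAbove_right_injective.ne hq))).filter_mono nhdsWithin_le_nhds] with c h _ using h
  obtain ⟨K, hK⟩ : ∃ K : ℝ, ∀ k, L (e k) < K :=
    (eventually_all.2 fun k => eventually_gt_atTop (L (e k))).exists
  have hKpos : 0 < K := hc.trans ((hcL Classical.ofNonempty).trans (hK _))
  obtain ⟨M, hM⟩ := hF ((c / K) * (c / K) ^ (n * (n - 1) / 2)) (by positivity)
  have e1 : ∀ᶠ m in atTop, ∀ k, c < dist (f (e k) m) p / r m :=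
    eventually_all.2 fun k => (hL (e k)).eventually_const_lt (hcL k)
  have e2 : ∀ᶠ m in atTop, ∀ k, dist (f (e k) m) p / r m < K :=
    eventually_all.2 fun k => (hL (e k)).eventually_lt_const (hK k)
  have e3 : ∀ᶠ m in atTop, ∀ q : Fin n × Fin n, q.1 ≠ q.2 →
      c < dist (f (e q.1) m) (f (e q.2) m) / r m := by
    refine eventually_all.2 fun q => ?_
    by_cases hq : q.1 = q.2
    · exact Eventually.of_forall fun c h => absurd hq h
    · filter_upwards [(hD (e q.1) (e q.2)).eventually_const_lt (hcD q hq)] with m h _ using h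
  have e4 : ∀ᶠ m in atTop, ∀ k, M ≤ dist (f (e k) m) p :=
    eventually_all.2 fun k => (hf (e k)).1.eventually_ge_atTop M
  obtain ⟨m, ⟨⟨h1, h2⟩, h3⟩, h4⟩ := (((e1.and e2).and e3).and e4).exists
  refine (hM (fun k => f (e k) m) h4).not_ge ?_
  exact le_Fn hc (hr.1 m) (fun k => (h1 k).le) (fun k => (h2 k).le)
    fun k l hkl => (h3 (k, l) hkl).le

/-- If `F_n` does not tend to zero, then some scaling sequence admits `n + 1` pairwise mutually
stable and inequivalent admissible sequences. -/
lemma exists_stable_family_of_not_Fn_small {X : Type*} [MetricSpace X]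
    (hX : ¬ Bornology.IsBounded (Set.univ : Set X)) {p : X} {n : ℕ} [Nonempty (Fin n)]
    {ε : ℝ} (hε : 0 < ε)
    (hF : ∀ M : ℝ, ∃ x : Fin n → X, (∀ k, M ≤ dist (x k) p) ∧ ε ≤ Fn p x) :
    ∃ r, ScalingSeq r ∧ ∃ f : Fin (n + 1) → ℕ → X, (∀ k, SeqAdm dist p r (f k)) ∧
      (∀ k l, MutStable dist r (f k) (f l)) ∧ ∀ k l, k ≠ l → ¬ SeqEquiv dist r (f k) (f l) := by
  have hunb : ∀ m : ℕ, ∃ y : X, (m : ℝ) + 1 ≤ dist y p := by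
    intro m
    by_contra! h
    exact hX (Metric.isBounded_closedBall.subset (s := Set.univ)
      fun y _ => Metric.mem_closedBall.2 (h y).le)
  choose y hy using hunb
  choose x hx hFx using fun m : ℕ => hF ((m + 1) * dist (y m) p)
  let s : ℕ → ℝ := fun m => ⨆ k, dist (x m k) p
  have hypos : ∀ m, 0 < dist (y m) p := fun m => lt_of_lt_of_le (by positivity) (hy m)
  have hyx : ∀ m k, dist (y m) p ≤ dist (x m k) p := fun m k =>
    (le_mul_of_one_le_left dist_nonneg (by simp)).trans (hx m k)
  have hxs : ∀ m k, dist (x m k) p ≤ s m := fun m k => dist_le_iSup_dist p (x m) k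
  have k₁ : Fin n := Classical.ofNonempty
  have hspos : ∀ m, 0 < s m := fun m => (hypos m).trans_le ((hyx m k₁).trans (hxs m k₁))
  have hxne : ∀ m, ¬ ∀ k, x m k = p := fun m h =>
    ((hypos m).trans_le (hyx m k₁)).ne' (by rw [h k₁, dist_self])
  let g : ℕ → Fin (n + 1) → X := fun m => Fin.cons (y m) (x m)
  have hg0 : ∀ m, g m 0 = y m := fun m => rfl
  have hgs : ∀ m k, g m (Fin.succ k) = x m k := fun m k => rfl
  have hgl : ∀ (m : ℕ) k, (m : ℝ) ≤ dist (g m k) p := by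
    intro m k
    refine Fin.cases ?_ (fun k => ?_) k
    · rw [hg0]; linarith [hy m]
    · rw [hgs]; linarith [hy m, hyx m k]
  have hgu : ∀ m k, dist (g m k) p ≤ s m := by
    intro m k
    refine Fin.cases ?_ (fun k => ?_) k
    · exact (hyx m k₁).trans (hxs m k₁)
    · exact hxs m k
  let u : ℕ → (Fin (n + 1) → ℝ) × (Fin (n + 1) × Fin (n + 1) → ℝ) := fun m =>
    (fun k => dist (g m k) p / s m, fun q => dist (g m q.1) (g m q.2) / s m)
  have hu : ∀ m, u m ∈ Metric.closedBall 0 2 := by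
    intro m
    rw [mem_closedBall_zero_iff, Prod.norm_def, max_le_iff,
      pi_norm_le_iff_of_nonneg zero_le_two, pi_norm_le_iff_of_nonneg zero_le_two]
    refine ⟨fun k => ?_, fun q => ?_⟩
    · rw [Real.norm_of_nonneg (div_nonneg dist_nonneg (hspos m).le), div_le_iff₀ (hspos m)]
      linarith [hgu m k, hspos m]
    · rw [Real.norm_of_nonneg (div_nonneg dist_nonneg (hspos m).le), div_le_iff₀ (hspos m)]
      linarith [hgu m q.1, hgu m q.2, dist_triangle_right (g m q.1) (g m q.2) p]
  obtain ⟨⟨L, D⟩, -, φ, hφ, hlim⟩ := tendsto_subseq_of_bounded Metric.isBounded_closedBall hu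
  have hL : ∀ k, Tendsto (fun j => dist (g (φ j) k) p / s (φ j)) atTop (𝓝 (L k)) := fun k =>
    ((continuous_apply k).tendsto L).comp ((continuous_fst.tendsto (L, D)).comp hlim)
  have hD : ∀ q : Fin (n + 1) × Fin (n + 1),
      Tendsto (fun j => dist (g (φ j) q.1) (g (φ j) q.2) / s (φ j)) atTop (𝓝 (D q)) := fun q =>
    ((continuous_apply q).tendsto D).comp ((continuous_snd.tendsto (L, D)).comp hlim)
  have hφcast : Tendsto (fun j => ((φ j : ℕ) : ℝ)) atTop atTop :=
    tendsto_natCast_atTop_atTop.comp hφ.tendsto_atTop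
  have hy0 : Tendsto (fun j => dist (y (φ j)) p / s (φ j)) atTop (𝓝 0) := by
    refine (squeeze_zero (g := fun m : ℕ => 1 / ((m : ℝ) + 1))
      (fun m => div_nonneg dist_nonneg (hspos m).le) (fun m => ?_)
      tendsto_one_div_add_atTop_nhds_zero_nat).comp hφ.tendsto_atTop
    rw [div_le_div_iff₀ (hspos m) (by positivity)]
    linarith [hx m k₁, hxs m k₁]
  have hnot : ∀ t : ℕ → ℝ, (∀ j, ε ≤ 2 ^ (n * (n - 1) / 2) * t j) → ¬ Tendsto t atTop (𝓝 0) :=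
    fun t ht h => hε.not_ge (by simpa using ge_of_tendsto' (h.const_mul _) ht)
  have hsucc : ∀ k, ¬ SeqEquiv dist (s ∘ φ) (fun j => y (φ j)) (fun j => x (φ j) k) := by
    intro k h
    refine hnot (fun j => dist (x (φ j) k) p / s (φ j))
      (fun j => (hFx _).trans (Fn_le_mul_dist_point (hxne _) k)) ?_
    refine squeeze_zero (fun j => div_nonneg dist_nonneg (hspos _).le) (fun j => ?_)
      (by simpa using Tendsto.add h hy0)
    rw [← add_div]
    exact div_le_div_of_nonneg_right (dist_triangle_left _ _ _ |>.trans_eq (by ring))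
      (hspos _).le
  refine ⟨s ∘ φ, ⟨fun j => hspos _, tendsto_atTop_mono (fun j => (hgl _ 0).trans (hgu _ 0)) hφcast⟩,
    fun k j => g (φ j) k,
    fun k => ⟨tendsto_atTop_mono (fun j => hgl _ k) hφcast, L k, hL k⟩,
    fun k l => ⟨D (k, l), hD (k, l)⟩, fun k l => ?_⟩
  refine Fin.cases ?_ (fun k => ?_) k <;> refine Fin.cases ?_ (fun l => ?_) l
  · exact fun h => absurd rfl h
  · exact fun _ => hsucc l
  · intro _ h
    exact hsucc k (by simpa only [SeqEquiv, dist_comm, hg0, hgs] using h)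
  · intro hkl h
    exact hnot _ (fun j => (hFx _).trans
      (Fn_le_mul_dist_pair (hxne _) (fun h => hkl (congrArg Fin.succ h)))) h

/-- **Theorem 2.1.** Let `(X,d)` be an unbounded metric space, `p ∈ X` and
`n ≥ 2`.  The inequality `|Ω^X_{∞,r̃}| ≤ n` holds for every pretangent space `Ω^X_{∞,r̃}`
(over every scaling sequence `r̃`) if and only if `F_n(x₁,…,xₙ) → 0` as `x₁,…,xₙ → ∞`
(i.e. as `min_k d(x_k,p) → ∞`).  The cardinality bound is expressed by: among any `n+1`
members of a pretangent clique two are equivalent. -/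
theorem card_pretangent_le_iff {X : Type*} [MetricSpace X]
    (hX : ¬ Bornology.IsBounded (Set.univ : Set X)) (p : X) (n : ℕ) (hn : 2 ≤ n) :
    (∀ r : ℕ → ℝ, ScalingSeq r → ∀ C : Set (ℕ → X), IsPretangent dist p r C →
      ∀ f : Fin (n + 1) → (ℕ → X), (∀ k, f k ∈ C) →
        ∃ k l, k ≠ l ∧ SeqEquiv dist r (f k) (f l)) ↔
    (∀ ε > (0 : ℝ), ∃ M : ℝ, ∀ x : Fin n → X, (∀ k, M ≤ dist (x k) p) → Fn p x < ε) := by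
  have : Nonempty (Fin n) := ⟨⟨0, by omega⟩⟩
  constructor
  · intro h
    by_contra! hF
    obtain ⟨ε, hε, hF⟩ := hF
    obtain ⟨r, hr, f, hf, hs, hne⟩ := exists_stable_family_of_not_Fn_small hX hε hF
    obtain ⟨C, hC, hsub⟩ := (isCliqueSet_saturation hr hs).exists_isPretangent
    obtain ⟨k, l, hkl, he⟩ := h r hr C hC f fun k =>
      hsub ⟨hf k, k, by simp [SeqEquiv]⟩
    exact hne k l hkl he
  · intro hF r hr C hC f hf
    exact exists_seqEquiv_of_Fn_small hF hr (fun k => hC.1.1 _ (hf k))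
      fun k l => hC.1.2.2 _ (hf k) _ (hf l)
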